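/- For every continuous (n₁,…,nₘ)-homogeneous polynomial P : E₁×⋯×Eₘ → F there exists a unique continuous (n₁,…,nₘ)-symmetric (n₁+⋯+nₘ)-linear map P̌ : E₁^{n₁}×⋯×Eₘ^{nₘ} → F such that P(x₁,…,xₘ) = P̌(x₁,…,x₁,…,xₘ,…,xₘ) (each xᵢ repeated nᵢ times) for all x₁ ∈ E₁,…,xₘ ∈ Eₘ. -/

import Mathlib

open scoped BigOperators

/-- `P` is a continuous `(n₁,…,nₘ)`-homogeneous polynomial (multipolynomial): for each
coordinate `i` and each choice of the other variables, the map `y ↦ P (x with i-th entry y)`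
is a continuous `n i`-homogeneous polynomial on `E i`. -/
def IsMultipolynomial (𝕜 : Type*) [RCLike 𝕜] {m : ℕ} (n : Fin m → ℕ)
    {E : Fin m → Type*} [∀ i, NormedAddCommGroup (E i)] [∀ i, NormedSpace 𝕜 (E i)]
    {F : Type*} [NormedAddCommGroup F] [NormedSpace 𝕜 F]
    (P : ((i : Fin m) → E i) → F) : Prop :=
  ∀ (i : Fin m) (x : (j : Fin m) → E j),
    ∃ A : ContinuousMultilinearMap 𝕜 (fun _ : Fin (n i) => E i) F,
      ∀ y : E i, P (Function.update x i y) = A (fun _ => y)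

/-- A continuous `(n₁ + ⋯ + nₘ)`-linear map `T : E₁^{n₁} × ⋯ × Eₘ^{nₘ} → F` is
`(n₁,…,nₘ)`-symmetric if it is invariant under permuting, within each block `i`,
the `n i` variables from `E i`. -/
def BlockSymmetric {𝕜 : Type*} [RCLike 𝕜] {m : ℕ} {n : Fin m → ℕ}
    {E : Fin m → Type*} [∀ i, NormedAddCommGroup (E i)] [∀ i, NormedSpace 𝕜 (E i)]
    {F : Type*} [NormedAddCommGroup F] [NormedSpace 𝕜 F]
    (T : ContinuousMultilinearMap 𝕜 (fun p : Σ i : Fin m, Fin (n i) => E p.1) F) : Prop :=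
  ∀ (σ : (i : Fin m) → Equiv.Perm (Fin (n i)))
    (x : (p : Σ i : Fin m, Fin (n i)) → E p.1),
    T (fun p => x ⟨p.1, σ p.1 p.2⟩) = T x

open Finset Function in
/-- The alternating count of the sets avoided by a self-map detects surjectivity. -/
theorem sum_neg_one_pow_card_avoiding {R κ : Type*} [CommRing R] [Fintype κ] [DecidableEq κ]
    (f : κ → κ) :
    ∑ b : Finset κ, (if ∀ j, f j ∈ bᶜ then (-1 : R) ^ #b else 0) =
      if Bijective f then 1 else 0 := by
  have h : (univ.filter fun b : Finset κ => ∀ j, f j ∈ bᶜ) = (univ.image f)ᶜ.powerset := by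
    ext b
    simp only [mem_filter, mem_univ, true_and, mem_powerset, mem_compl, subset_iff, mem_image,
      not_exists]
    exact ⟨fun h y hy j hj => h j (hj ▸ hy), fun h j hj => h hj j rfl⟩
  rw [← sum_filter, h]
  have h₂ := congrArg (Int.cast : ℤ → R) (sum_powerset_neg_one_pow_card (x := (univ.image f)ᶜ))
  push_cast at h₂
  rw [h₂]
  simp only [compl_eq_empty_iff, ← Finite.surjective_iff_bijective]
  congr 1
  simp [Finset.eq_univ_iff_forall, Surjective]

open Finset Function in
/-- The polarization formula for a multilinear map which need not be symmetric. -/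
theorem MultilinearMap.sum_neg_one_pow_smul_map_sum_compl {𝕜 κ V W : Type*} [CommRing 𝕜]
    [Fintype κ] [DecidableEq κ] [AddCommGroup V] [Module 𝕜 V] [AddCommGroup W] [Module 𝕜 W]
    (A : MultilinearMap 𝕜 (fun _ : κ => V) W) (x : κ → V) :
    ∑ b : Finset κ, (-1 : 𝕜) ^ #b • A (fun _ => ∑ j ∈ bᶜ, x j) =
      ∑ σ : Equiv.Perm κ, A (fun j => x (σ j)) := by
  have h : ∀ b : Finset κ, (-1 : 𝕜) ^ #b • A (fun _ => ∑ j ∈ bᶜ, x j) =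
      ∑ f : κ → κ, (if ∀ j, f j ∈ bᶜ then (-1 : 𝕜) ^ #b else 0) • A (fun j => x (f j)) := by
    intro b
    rw [A.map_sum_finset (fun _ j => x j) (fun _ => bᶜ), smul_sum]
    simp only [ite_smul, zero_smul]
    rw [← sum_filter]
    congr 1
    ext f
    simp [Fintype.mem_piFinset]
  rw [sum_congr rfl fun b _ => h b, sum_comm]
  simp_rw [← sum_smul]
  simp only [sum_neg_one_pow_card_avoiding, ite_smul, one_smul, zero_smul]
  rw [← sum_filter]
  symm
  refine sum_bij (fun σ _ => ⇑σ) (fun σ _ => by simp)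
    (fun _ _ _ _ h => DFunLike.coe_injective h)
    (fun f hf => ⟨Equiv.ofBijective f (by simpa using hf), mem_univ _, rfl⟩) (fun _ _ => rfl)

open Finset in
theorem sum_neg_one_pow_mul_card_compl_pow {𝕜 κ : Type*} [CommRing 𝕜] [Fintype κ]
    [DecidableEq κ] :
    ∑ b : Finset κ, (-1 : 𝕜) ^ #b * (#bᶜ : 𝕜) ^ Fintype.card κ =
      ((Fintype.card κ).factorial : 𝕜) := by
  have h := (MultilinearMap.mkPiAlgebra 𝕜 κ 𝕜).sum_neg_one_pow_smul_map_sum_compl (fun _ => 1)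
  simpa [Fintype.card_perm] using h

open Finset Function in
theorem Fintype.sum_eq_sum_sum_update {ι M : Type*} {β : ι → Type*} [Fintype ι] [DecidableEq ι]
    [∀ i, Fintype (β i)] [∀ i, Inhabited (β i)] [AddCommMonoid M] (i : ι)
    (G : (∀ i, β i) → M) :
    ∑ b, G b = ∑ r : ∀ j : {j // j ≠ i}, β j,
      ∑ a : β i, G (update ((Equiv.piSplitAt i β).symm (default, r)) i a) := by
  rw [← (Equiv.piSplitAt i β).symm.sum_comp, Fintype.sum_prod_type, Finset.sum_comm]
  refine Finset.sum_congr rfl fun r _ => Finset.sum_congr rfl fun a _ => congrArg G ?_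
  ext j
  by_cases hj : j = i
  · subst hj; simp
  · simp [hj]

open Function in
/-- A separately continuous multilinear map on Banach spaces is bounded on the unit ball,
when the variables outside `s` are fixed. -/
theorem MultilinearMap.exists_bound_of_separately_continuous {𝕜 ι : Type*} [RCLike 𝕜]
    [DecidableEq ι] {E : ι → Type*} [∀ i, NormedAddCommGroup (E i)]
    [∀ i, NormedSpace 𝕜 (E i)] [∀ i, CompleteSpace (E i)]
    {F : Type*} [NormedAddCommGroup F] [NormedSpace 𝕜 F]
    (f : MultilinearMap 𝕜 E F) (hf : ∀ x i, Continuous fun y => f (update x i y))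
    (s : Finset ι) (x : ∀ i, E i) :
    ∃ C, ∀ y : ∀ i, E i, (∀ i ∉ s, y i = x i) → (∀ i ∈ s, ‖y i‖ ≤ 1) → ‖f y‖ ≤ C := by
  induction s using Finset.induction_on generalizing x with
  | empty =>
    refine ⟨‖f x‖, fun y hy _ => ?_⟩
    rw [show y = x from funext fun i => hy i (Finset.notMem_empty i)]
  | insert a s ha ih =>
    let I := {y : ∀ i, E i // (∀ i ∉ insert a s, y i = x i) ∧ ∀ i ∈ s, ‖y i‖ ≤ 1}
    let g : I → E a →L[𝕜] F := fun y => ⟨f.toLinearMap y.1 a, hf y.1 a⟩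
    have hg : ∀ z, ∃ C, ∀ y, ‖g y z‖ ≤ C := by
      intro z
      obtain ⟨C, hC⟩ := ih (update x a z)
      refine ⟨C, fun y => hC (update y.1 a z) (fun i hi => ?_) fun i hi => ?_⟩
      · by_cases hia : i = a
        · subst hia; simp
        · simpa [hia] using y.2.1 i (by simp [hia, hi])
      · have hia : i ≠ a := fun h => ha (h ▸ hi)
        simpa [hia] using y.2.2 i hi
    obtain ⟨C, hC⟩ := banach_steinhaus hg
    refine ⟨C, fun y hy hy₁ => ?_⟩
    let y' : I := ⟨y, hy, fun i hi => hy₁ i (Finset.mem_insert_of_mem hi)⟩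
    have h : f y = g y' (y a) := by
      change f y = f (update y a (y a))
      rw [update_eq_self]
    rw [h]
    exact (g y').le_of_opNorm_le_of_le (hC y') (hy₁ a (Finset.mem_insert_self a s)) |>.trans_eq
      (mul_one C)

open Function in
/-- A separately continuous multilinear map on Banach spaces is continuous. -/
theorem MultilinearMap.continuous_of_separately_continuous {𝕜 ι : Type*} [RCLike 𝕜]
    [Fintype ι] [DecidableEq ι] {E : ι → Type*} [∀ i, NormedAddCommGroup (E i)]
    [∀ i, NormedSpace 𝕜 (E i)] [∀ i, CompleteSpace (E i)]
    {F : Type*} [NormedAddCommGroup F] [NormedSpace 𝕜 F]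
    (f : MultilinearMap 𝕜 E F) (hf : ∀ x i, Continuous fun y => f (update x i y)) :
    Continuous f := by
  obtain ⟨C, hC⟩ := f.exists_bound_of_separately_continuous hf Finset.univ 0
  have hC₀ : 0 ≤ C := (norm_nonneg _).trans (hC 0 (by simp) (by simp))
  refine f.continuous_of_bound (C * 2 ^ Fintype.card ι) ?_
  refine f.bound_of_shell (ε := fun _ => 1) (c := fun _ => 2) (by simp) (by simp) ?_
  intro y hy hy₁
  have h : (2⁻¹ : ℝ) ^ Fintype.card ι ≤ ∏ i, ‖y i‖ := by
    have := Finset.prod_le_prod (s := Finset.univ) (f := fun _ : ι => (2⁻¹ : ℝ))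
      (g := fun i => ‖y i‖) (by simp) (fun i _ => by simpa using hy i)
    simpa using this
  calc ‖f y‖ ≤ C := hC y (by simp) fun i _ => (hy₁ i).le
    _ = C * 2 ^ Fintype.card ι * 2⁻¹ ^ Fintype.card ι := by
      rw [mul_assoc, ← mul_pow]; simp
    _ ≤ _ := by gcongr

section Polarization

open Finset Function

variable {𝕜 : Type*} [RCLike 𝕜] {m : ℕ} {n : Fin m → ℕ}
  {E : Fin m → Type*} [∀ i, NormedAddCommGroup (E i)]
  {F : Type*} [NormedAddCommGroup F] [NormedSpace 𝕜 F]

/-- The vector whose `i`-th entry is the sum of the variables of block `i` not in `b i`. -/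
def blockSum (b : ∀ i, Finset (Fin (n i))) (x : (p : Σ i : Fin m, Fin (n i)) → E p.1) :
    ∀ i, E i :=
  fun i => ∑ j ∈ (b i)ᶜ, x ⟨i, j⟩

variable (𝕜) in
/-- The (unnormalized) polarization of `P`. -/
def polarize (P : (∀ i, E i) → F) (x : (p : Σ i : Fin m, Fin (n i)) → E p.1) : F :=
  ∑ b : ∀ i, Finset (Fin (n i)), (∏ i, (-1 : 𝕜) ^ #(b i)) • P (blockSum b x)

theorem polarize_perm (P : (∀ i, E i) → F) (σ : ∀ i, Equiv.Perm (Fin (n i)))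
    (x : (p : Σ i : Fin m, Fin (n i)) → E p.1) :
    polarize 𝕜 P (fun p => x ⟨p.1, σ p.1 p.2⟩) = polarize 𝕜 P x := by
  refine Fintype.sum_equiv (Equiv.piCongrRight fun i => (σ i).finsetCongr) _ _ fun b => ?_
  congr 1
  · simp
  · congr 1
    ext i
    refine sum_equiv (σ i) (fun j => ?_) fun _ _ => rfl
    simp

variable [∀ i, NormedSpace 𝕜 (E i)]

theorem IsMultipolynomial.map_smul {P : (∀ i, E i) → F} (hP : IsMultipolynomial 𝕜 n P)
    (c : Fin m → 𝕜) (x : ∀ i, E i) :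
    P (fun i => c i • x i) = (∏ i, c i ^ n i) • P x := by
  have h : ∀ s : Finset (Fin m),
      P (fun i => if i ∈ s then c i • x i else x i) = (∏ i ∈ s, c i ^ n i) • P x := by
    intro s
    induction s using Finset.induction_on with
    | empty => simp
    | insert a s ha ih =>
      set w : ∀ i, E i := fun i => if i ∈ s then c i • x i else x i
      obtain ⟨A, hA⟩ := hP a w
      have h₁ : (fun i => if i ∈ insert a s then c i • x i else x i) =
          update w a (c a • x a) := by
        ext i
        by_cases hi : i = a
        · subst hi; simp
        · simp [hi, w]
      have h₂ : w = update w a (x a) := by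
        rw [eq_comm, update_eq_self_iff]; simp [w, ha]
      rw [h₁, hA, A.map_smul_univ (fun _ => c a) (fun _ => x a), ← hA, ← h₂, ih,
        prod_insert ha, smul_smul]
      simp
  simpa using h univ

/-- In the variables of a single block, the polarization of a multipolynomial is a continuous
multilinear map. -/
theorem IsMultipolynomial.exists_polarize_eq {P : (∀ i, E i) → F}
    (hP : IsMultipolynomial 𝕜 n P) (i : Fin m)
    (x : (p : Σ i : Fin m, Fin (n i)) → E p.1) :
    ∃ B : ContinuousMultilinearMap 𝕜 (fun _ : Fin (n i) => E i) F,
      ∀ y : (p : Σ i : Fin m, Fin (n i)) → E p.1,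
        (∀ k ≠ i, ∀ j, y ⟨k, j⟩ = x ⟨k, j⟩) → polarize 𝕜 P y = B fun j => y ⟨i, j⟩ := by
  let e (r : ∀ j : {j // j ≠ i}, Finset (Fin (n j))) : ∀ k, Finset (Fin (n k)) :=
    (Equiv.piSplitAt i _).symm (default, r)
  choose A hA using fun r => hP i (blockSum (e r) x)
  refine ⟨∑ r, (∏ k ∈ univ \ {i}, (-1 : 𝕜) ^ #(e r k)) •
    ∑ σ : Equiv.Perm (Fin (n i)), (A r).domDomCongr σ, fun y hy => ?_⟩
  rw [polarize, Fintype.sum_eq_sum_sum_update i]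
  simp only [_root_.sum_apply, _root_.smul_apply]
  refine sum_congr rfl fun r _ => ?_
  have hpol := (A r).toMultilinearMap.sum_neg_one_pow_smul_map_sum_compl fun j => y ⟨i, j⟩
  change _ = (∏ k ∈ univ \ {i}, (-1 : 𝕜) ^ #(e r k)) •
    ∑ σ : Equiv.Perm (Fin (n i)), (A r) (fun j => y ⟨i, σ j⟩)
  change _ = ∑ σ : Equiv.Perm (Fin (n i)), (A r) (fun j => y ⟨i, σ j⟩) at hpol
  rw [← hpol, smul_sum]
  refine sum_congr rfl fun a _ => ?_
  change (∏ k, (-1 : 𝕜) ^ #(update (e r) i a k)) • P (blockSum (update (e r) i a) y) =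
    _ • _ • A r (fun _ => ∑ j ∈ aᶜ, y ⟨i, j⟩)
  rw [← hA, smul_smul]
  congr 1
  · rw [← prod_sdiff (subset_univ {i}), prod_singleton, update_self]
    congr 1
    refine prod_congr rfl fun k hk => ?_
    rw [update_of_ne (by simpa using hk)]
  · congr 1
    ext k
    by_cases hk : k = i
    · subst hk; simp [blockSum]
    · simp [blockSum, hk, hy k hk]

theorem IsMultipolynomial.exists_polarize_update {P : (∀ i, E i) → F}
    (hP : IsMultipolynomial 𝕜 n P) (x : (p : Σ i : Fin m, Fin (n i)) → E p.1)
    (p : Σ i : Fin m, Fin (n i)) :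
    ∃ L : E p.1 →L[𝕜] F, ∀ y, polarize 𝕜 P (update x p y) = L y := by
  obtain ⟨i, j⟩ := p
  obtain ⟨B, hB⟩ := hP.exists_polarize_eq i x
  refine ⟨B.toContinuousLinearMap (fun l => x ⟨i, l⟩) j, fun y => ?_⟩
  rw [hB]
  · change _ = B (update _ j y)
    congr 1
    ext l
    by_cases hl : l = j
    · subst hl; simp
    · rw [update_of_ne (by simp [hl]), update_of_ne hl]
  · intro k hk l
    rw [update_of_ne (by simp [hk])]

/-- The polarization of a multipolynomial on Banach spaces, as a continuous multilinear map. -/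
noncomputable def IsMultipolynomial.polarization [∀ i, CompleteSpace (E i)] {P : (∀ i, E i) → F}
    (hP : IsMultipolynomial 𝕜 n P) :
    ContinuousMultilinearMap 𝕜 (fun p : Σ i : Fin m, Fin (n i) => E p.1) F :=
  let f : MultilinearMap 𝕜 (fun p : Σ i : Fin m, Fin (n i) => E p.1) F :=
    MultilinearMap.mk' (polarize 𝕜 P)
      (fun x p u v => by
        obtain ⟨L, hL⟩ := hP.exists_polarize_update x p
        simp only [hL, map_add])
      (fun x p c u => by
        obtain ⟨L, hL⟩ := hP.exists_polarize_update x p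
        simp only [hL, _root_.map_smul])
  { f with
    cont := f.continuous_of_separately_continuous fun x p => by
      obtain ⟨L, hL⟩ := hP.exists_polarize_update x p
      exact L.continuous.congr fun y => (hL y).symm }

theorem IsMultipolynomial.polarization_apply [∀ i, CompleteSpace (E i)] {P : (∀ i, E i) → F}
    (hP : IsMultipolynomial 𝕜 n P) (x : (p : Σ i : Fin m, Fin (n i)) → E p.1) :
    hP.polarization x = polarize 𝕜 P x :=
  rfl

theorem IsMultipolynomial.polarize_diag {P : (∀ i, E i) → F} (hP : IsMultipolynomial 𝕜 n P)
    (x : ∀ i, E i) :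
    polarize 𝕜 P (fun p : Σ i : Fin m, Fin (n i) => x p.1) =
      (∏ i, ((n i).factorial : 𝕜)) • P x := by
  have h : ∀ b : ∀ i, Finset (Fin (n i)),
      blockSum b (fun p : Σ i : Fin m, Fin (n i) => x p.1) =
        fun i => (#(b i)ᶜ : 𝕜) • x i := by
    intro b
    ext i
    rw [Nat.cast_smul_eq_nsmul]
    exact sum_const (x i)
  have h₂ : ∀ i, ((n i).factorial : 𝕜) =
      ∑ b : Finset (Fin (n i)), (-1 : 𝕜) ^ #b * (#bᶜ : 𝕜) ^ n i := fun i => by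
    simpa using (sum_neg_one_pow_mul_card_compl_pow (𝕜 := 𝕜) (κ := Fin (n i))).symm
  simp only [polarize, h, hP.map_smul, smul_smul, ← prod_mul_distrib, ← sum_smul, h₂]
  rw [Fintype.prod_sum]

/-- A block-symmetric map is determined by its values on the diagonal. -/
theorem BlockSymmetric.eq_of_diag
    {T U : ContinuousMultilinearMap 𝕜 (fun p : Σ i : Fin m, Fin (n i) => E p.1) F}
    (hT : BlockSymmetric T) (hU : BlockSymmetric U)
    (h : ∀ x : ∀ i, E i, T (fun p => x p.1) = U (fun p => x p.1)) : T = U := by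
  classical
  let K : 𝕜 := ∑ r : (p : Σ i : Fin m, Fin (n i)) → Fin (n p.1),
    if ∀ i, Bijective (β := Fin (n i)) fun j => r ⟨i, j⟩ then 1 else 0
  have key : ∀ V : ContinuousMultilinearMap 𝕜 (fun p : Σ i : Fin m, Fin (n i) => E p.1) F,
      BlockSymmetric V → ∀ x, polarize 𝕜 (fun y => V fun p => y p.1) x = K • V x := by
    intro V hV x
    have h₁ : ∀ b : ∀ i, Finset (Fin (n i)),
        (∏ i, (-1 : 𝕜) ^ #(b i)) • V (fun p => blockSum b x p.1) =
          ∑ r : (p : Σ i : Fin m, Fin (n i)) → Fin (n p.1),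
            (∏ i, if ∀ j, r ⟨i, j⟩ ∈ (b i)ᶜ then (-1 : 𝕜) ^ #(b i) else 0) •
              V (fun p => x ⟨p.1, r p⟩) := by
      intro b
      have := V.map_sum_finset (fun p j => x ⟨p.1, j⟩) (fun p => (b p.1)ᶜ)
      simp only [blockSum]
      rw [this, smul_sum]
      simp only [prod_ite_zero, ite_smul, zero_smul]
      rw [← sum_filter]
      congr 1
      ext r
      simp [Fintype.mem_piFinset, Sigma.forall]
    simp only [polarize, h₁]
    rw [sum_comm, sum_smul]
    refine sum_congr rfl fun r _ => ?_
    have hr : ∀ i, ∑ c : Finset (Fin (n i)),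
        (if ∀ j, r ⟨i, j⟩ ∈ cᶜ then (-1 : 𝕜) ^ #c else 0) =
          if Bijective (β := Fin (n i)) fun j => r ⟨i, j⟩ then 1 else 0 := fun i => by
      convert sum_neg_one_pow_card_avoiding (R := 𝕜) (κ := Fin (n i)) fun j => r ⟨i, j⟩
    rw [← sum_smul, ← Fintype.prod_sum
      (fun i (c : Finset (Fin (n i))) =>
        if ∀ j, r ⟨i, j⟩ ∈ cᶜ then (-1 : 𝕜) ^ #c else 0)]
    by_cases hbij : ∀ i, Bijective (β := Fin (n i)) fun j => r ⟨i, j⟩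
    · rw [if_pos hbij, prod_eq_one fun i _ => (hr i).trans (if_pos (hbij i)), one_smul, one_smul]
      exact hV (fun i => Equiv.ofBijective _ (hbij i)) x
    · obtain ⟨i, hi⟩ := not_forall.1 hbij
      rw [if_neg hbij, prod_eq_zero (mem_univ i) ((hr i).trans (if_neg hi)), zero_smul, zero_smul]
  have hK : K ≠ 0 := by
    simp only [K, sum_boole, Nat.cast_ne_zero, card_ne_zero]
    exact ⟨fun p => p.2, mem_filter.2 ⟨mem_univ _, fun _ => bijective_id⟩⟩
  ext x
  refine smul_right_injective F hK ?_
  simp only [← key T hT, ← key U hU, h]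

end Polarization

/-- For every continuous `(n₁,…,nₘ)`-homogeneous polynomial `P : E₁ × ⋯ × Eₘ → F` there is
a unique continuous `(n₁,…,nₘ)`-symmetric `(n₁ + ⋯ + nₘ)`-linear map
`P̌ : E₁^{n₁} × ⋯ × Eₘ^{nₘ} → F` with `P(x₁,…,xₘ) = P̌(x₁,…,x₁,…,xₘ,…,xₘ)` (each `xᵢ`
repeated `nᵢ` times). -/
theorem existsUnique_blockSymmetric_of_multipolynomial
    {𝕜 : Type*} [RCLike 𝕜] {m : ℕ} (n : Fin m → ℕ) (hn : ∀ i, 0 < n i)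
    {E : Fin m → Type*} [∀ i, NormedAddCommGroup (E i)] [∀ i, NormedSpace 𝕜 (E i)]
    [∀ i, CompleteSpace (E i)]
    {F : Type*} [NormedAddCommGroup F] [NormedSpace 𝕜 F] [CompleteSpace F]
    (P : ((i : Fin m) → E i) → F) (hP : IsMultipolynomial 𝕜 n P) :
    ∃! T : ContinuousMultilinearMap 𝕜 (fun p : Σ i : Fin m, Fin (n i) => E p.1) F,
      BlockSymmetric T ∧ ∀ x : (i : Fin m) → E i, P x = T (fun p => x p.1) := by
  have hN : (∏ i, ((n i).factorial : 𝕜)) ≠ 0 :=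
    Finset.prod_ne_zero_iff.2 fun i _ => Nat.cast_ne_zero.2 (n i).factorial_ne_zero
  refine ⟨(∏ i, ((n i).factorial : 𝕜))⁻¹ • hP.polarization, ⟨fun σ x => ?_, fun x => ?_⟩, ?_⟩
  · simp only [_root_.smul_apply, hP.polarization_apply, polarize_perm]
  · rw [_root_.smul_apply, hP.polarization_apply, hP.polarize_diag,
      inv_smul_smul₀ hN]
  · rintro U ⟨hU, hUP⟩
    refine hU.eq_of_diag (fun σ x => ?_) fun x => ?_
    · simp only [_root_.smul_apply, hP.polarization_apply, polarize_perm]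
    · rw [← hUP, _root_.smul_apply, hP.polarization_apply, hP.polarize_diag,
        inv_smul_smul₀ hN]
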